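/- Let M be a finite functional causal model on a directed graph G, and consider two teleportation fCMs M_1, M_2 on the same classical teleportation graph G^s ∈ F(G), constructed from M using two possibly different choices of classical post-selected teleportation protocols at each split vertex. Then M_1 has nonzero post-selection success probability if and only if M_2 does, and in that case the conditional probabilities P_acyc(x | {t_T = 1}_{T∈T})_{G^s} computed from M_1 and from M_2 coincide for every joint assignment x = {x_v ∈ X_v}_{v∈V}. -/

import Mathlib

open Finset

noncomputable section

/-- The Kronecker delta `δ_{x,y}` as a real number: `1` if `x = y` and `0` otherwise. -/
def kron {α : Type*} (x y : α) : ℝ := by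
  classical exact if x = y then 1 else 0

/-- A probability distribution on a finite type: values in `[0,1]` summing to `1`. -/
def IsProbDist {α : Type*} [Fintype α] (p : α → ℝ) : Prop :=
  (∀ a, 0 ≤ p a ∧ p a ≤ 1) ∧ ∑ a, p a = 1

/-- A directed graph (vertex type `V`, edge relation `E`) is acyclic if it contains no
directed cycle. -/
def Acyclic {V : Type*} (E : V → V → Prop) : Prop :=
  ∀ v, ¬ Relation.TransGen E v v

/-- A finite functional causal model (fCM) on a directed graph `G = (V, E)` with finite
vertex set: each vertex `v` carries a nonempty finite set `X v` of values, a finite set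
`U v` of error values with a probability distribution `pU v`, and a function
`f v : X_{pa(v)} × U_v → X_v` (the dependence on the parents `pa(v) = {w : E w v}` is
encoded by giving `f v` access to the values of all `w` with `E w v`). -/
structure FCM (V : Type) [Fintype V] [DecidableEq V] (E : V → V → Prop) where
  X : V → Type
  fintX : ∀ v, Fintype (X v)
  neX : ∀ v, Nonempty (X v)
  U : V → Type
  fintU : ∀ v, Fintype (U v)
  pU : ∀ v, U v → ℝ
  pU_mem : ∀ v u, 0 ≤ pU v u ∧ pU v u ≤ 1
  pU_sum : ∀ v, letI := fintU v; (∑ u, pU v u) = 1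
  f : ∀ v, (∀ w, E w v → X w) → U v → X v

attribute [instance] FCM.fintX FCM.neX FCM.fintU

variable {V : Type} [Fintype V] [DecidableEq V] {E : V → V → Prop}

/-- The number of solutions `N(u)` of an fCM for a valuation `u` of the error variables. -/
def FCM.Nsol (M : FCM V E) (u : ∀ v, M.U v) : ℝ :=
  ∑ x : ∀ v, M.X v, ∏ v, kron (M.f v (fun w _ => x w) (u v)) (x v)

/-- The average number of solutions `N̄ = Σ_u N(u) Π_v p^v(u_v)` of an fCM. -/
def FCM.Nbar (M : FCM V E) : ℝ :=
  ∑ u : ∀ v, M.U v, M.Nsol u * ∏ v, M.pU v (u v)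

/-- The data of a teleportation fCM on the classical teleportation graph `G^s` obtained from
an fCM `M` by splitting the vertices of `S`: for each split vertex `v ∈ S`, the
pre-selection vertex `R_v` carries the set `X v` with distribution `qC v`, and the
post-selection vertex `T_v` carries the set `{0,1}` with error set `B v` (distributed as
`qB v`) and function `τ v : X v × B v × X v → {0,1}`, such that `(τ v, qB v, qC v)` is a
classical post-selected teleportation protocol with success probability `lam v ∈ (0,1]`. -/
structure TeleProto {V : Type} [Fintype V] [DecidableEq V] {E : V → V → Prop}
    (M : FCM V E) (S : Finset V) where
  B : V → Type
  fintB : ∀ v, Fintype (B v)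
  qB : ∀ v, B v → ℝ
  qC : ∀ v, M.X v → ℝ
  tau : ∀ v, M.X v → B v → M.X v → Fin 2
  lam : V → ℝ
  qB_dist : ∀ v ∈ S, letI := fintB v; IsProbDist (qB v)
  qC_dist : ∀ v ∈ S, IsProbDist (qC v)
  lam_mem : ∀ v ∈ S, 0 < lam v ∧ lam v ≤ 1
  proto : ∀ v ∈ S, ∀ p : M.X v → ℝ, IsProbDist p → ∀ c : M.X v,
    letI := fintB v;
    (∑ a, ∑ b, p a * kron (tau v a b c) 1 * qB v b * qC v c) = lam v * p c

attribute [instance] TeleProto.fintB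

/-- The input to the functions of the teleportation fCM: for each split vertex `w ∈ S`, the
pre-selection vertex `R_w` (with value `r w`) substitutes `w` as input to the functions of
the children of `w`. -/
def teleArg (M : FCM V E) (S : Finset V)
    (x : ∀ v, M.X v) (r : ∀ v : {w // w ∈ S}, M.X v.1) : ∀ v, M.X v :=
  fun v => if h : v ∈ S then r ⟨v, h⟩ else x v

/-- The acyclic probability rule applied to the teleportation fCM: the joint probability
`P_acyc(x, r, t)_{G^s}` of values `x` on the original vertices, `r` on the pre-selection
vertices and `t` on the post-selection vertices. -/
def telePacyc (M : FCM V E) (S : Finset V) (T : TeleProto M S)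
    (x : ∀ v, M.X v) (r : ∀ v : {w // w ∈ S}, M.X v.1)
    (t : {w // w ∈ S} → Fin 2) : ℝ :=
  ∑ u : ∀ v, M.U v, ∑ b : ∀ v : {w // w ∈ S}, T.B v.1,
    (∏ v, M.pU v (u v) * kron (x v) (M.f v (fun w _ => teleArg M S x r w) (u v))) *
    ∏ v : {w // w ∈ S},
      T.qC v.1 (r v) * T.qB v.1 (b v) * kron (t v) (T.tau v.1 (x v.1) (b v) (r v))

/-- The post-selection success probability
`P_succ = P_acyc({t_{T_v} = 1}_{v ∈ S})_{G^s} = Σ_{x,r} P_acyc(x, r, {t_{T_v} = 1})_{G^s}`. -/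
def Psucc (M : FCM V E) (S : Finset V) (T : TeleProto M S) : ℝ :=
  ∑ x : ∀ v, M.X v, ∑ r : ∀ v : {w // w ∈ S}, M.X v.1,
    telePacyc M S T x r fun _ => 1

/-- The conditional probability `P_acyc(x | {t_T = 1}_{T ∈ 𝒯})_{G^s}` of a joint assignment
`x` on the original vertices given successful post-selection (the pre-selection values being
marginalized). -/
def Pcond (M : FCM V E) (S : Finset V) (T : TeleProto M S) (x : ∀ v, M.X v) : ℝ :=
  (∑ r : ∀ v : {w // w ∈ S}, M.X v.1, telePacyc M S T x r fun _ => 1) / Psucc M S T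

theorem kron_comm {α : Type*} (x y : α) : kron x y = kron y x := by
  unfold kron
  split_ifs <;> simp_all

/-- The point mass at `a` is a probability distribution. -/
theorem isProbDist_kron {α : Type*} [Fintype α] (a : α) : IsProbDist (kron a) := by
  classical
  refine ⟨fun c => ?_, by simp [kron]⟩
  unfold kron
  split_ifs <;> norm_num

/-- Applied to a point mass, a post-selected teleportation protocol succeeds exactly when the
pre-selected value agrees with the input. -/
theorem TeleProto.sum_success (M : FCM V E) (S : Finset V) (T : TeleProto M S)
    {v : V} (hv : v ∈ S) (a c : M.X v) :
    ∑ b, T.qC v c * T.qB v b * kron 1 (T.tau v a b c) = T.lam v * kron a c := by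
  classical
  rw [← T.proto v hv (kron a) (isProbDist_kron a) c, Finset.sum_eq_single a]
  · refine Finset.sum_congr rfl fun b _ => ?_
    have haa : kron a a = 1 := by simp [kron]
    rw [haa, kron_comm 1]
    ring
  · intro a' _ ha'
    have haa' : kron a a' = 0 := by simp [kron, ha'.symm]
    simp [haa']
  · simp

/-- The weight of `x` in the causal model, given that every pre-selected value agrees with the
value of the split vertex. -/
def agreementWeight (M : FCM V E) (S : Finset V) (x : ∀ v, M.X v) : ℝ :=
  ∑ r : ∀ v : {w // w ∈ S}, M.X v.1, ∑ u : ∀ v, M.U v,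
    (∏ v, M.pU v (u v) * kron (x v) (M.f v (fun w _ => teleArg M S x r w) (u v))) *
    ∏ v : {w // w ∈ S}, kron (x v.1) (r v)

/-- The joint probability of `x` and successful post-selection depends on the protocol only
through the product of the protocol success probabilities. -/
theorem sum_telePacyc_success (M : FCM V E) (S : Finset V) (T : TeleProto M S)
    (x : ∀ v, M.X v) :
    ∑ r : ∀ v : {w // w ∈ S}, M.X v.1, telePacyc M S T x r (fun _ => 1) =
      (∏ v : {w // w ∈ S}, T.lam v.1) * agreementWeight M S x := by
  simp only [agreementWeight, telePacyc, Finset.mul_sum]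
  refine Finset.sum_congr rfl fun r _ => Finset.sum_congr rfl fun u _ => ?_
  rw [← Finset.mul_sum, ← Fintype.prod_sum (fun (v : {w // w ∈ S}) (b : T.B v.1) =>
    T.qC v.1 (r v) * T.qB v.1 b * kron 1 (T.tau v.1 (x v.1) b (r v)))]
  simp only [fun v : {w // w ∈ S} => T.sum_success M S v.2 (x v.1) (r v),
    Finset.prod_mul_distrib]
  ring

theorem Psucc_eq (M : FCM V E) (S : Finset V) (T : TeleProto M S) :
    Psucc M S T = (∏ v : {w // w ∈ S}, T.lam v.1) * ∑ x, agreementWeight M S x := by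
  simp only [Psucc, sum_telePacyc_success, Finset.mul_sum]

theorem TeleProto.prod_lam_ne_zero (M : FCM V E) (S : Finset V) (T : TeleProto M S) :
    ∏ v : {w // w ∈ S}, T.lam v.1 ≠ 0 :=
  Finset.prod_ne_zero_iff.2 fun v _ => (T.lam_mem v.1 v.2).1.ne'

theorem Pcond_eq (M : FCM V E) (S : Finset V) (T : TeleProto M S) (x : ∀ v, M.X v) :
    Pcond M S T x = agreementWeight M S x / ∑ y, agreementWeight M S y := by
  rw [Pcond, sum_telePacyc_success, Psucc_eq, mul_div_mul_left _ _ (T.prod_lam_ne_zero M S)]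

/-- **equivalent probabilities from different protocol implementations.**
Let `M` be a finite functional causal model on a directed graph `G`, and consider two
teleportation fCMs `M_1, M_2` on the same classical teleportation graph `G^s ∈ F(G)` (with
split vertex set `S` such that removing all outgoing edges of vertices in `S` yields an
acyclic graph, and post-selection vertex set `𝒯`), constructed from `M` using two possibly
different choices of classical post-selected teleportation protocols at each split vertex.
Then `M_1` has nonzero post-selection success probability iff `M_2` does, and in that case
the conditional probabilities `P_acyc(x | {t_T = 1}_{T∈𝒯})_{G^s}` computed from `M_1` and
from `M_2` coincide for every joint assignment `x`. -/
theorem conditional_probabilities_independent_of_protocol_choice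
    {V : Type} [Fintype V] [DecidableEq V] {E : V → V → Prop}
    (M : FCM V E) (S : Finset V)
    (hS : Acyclic fun a b : V => E a b ∧ a ∉ S)
    (T1 T2 : TeleProto M S) :
    (Psucc M S T1 ≠ 0 ↔ Psucc M S T2 ≠ 0) ∧
    (Psucc M S T1 ≠ 0 →
      ∀ x : ∀ v, M.X v, Pcond M S T1 x = Pcond M S T2 x) := by
  refine ⟨?_, fun _ x => by rw [Pcond_eq, Pcond_eq]⟩
  simp only [Psucc_eq, mul_ne_zero_iff, T1.prod_lam_ne_zero M S, T2.prod_lam_ne_zero M S,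
    ne_eq, not_false_eq_true, true_and]
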